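/- Let C > 0 and let (α_k)_{k≥1} be a sequence of natural numbers with |α_{k+1} − α_k − k²| ≤ C·k for every k ≥ 1. Then there exists C' > 0 such that for all sufficiently large k, writing n = α_{k+1}, one has |(3n)^{2/3} − k²| ≤ C'·k and |(n − (3n)^{2/3}) − α_k| ≤ C'·k. -/

import Mathlib

/-- If consecutive differences of `a` are `k² + O(k)`, then `3 a k = k³ + O(k²)`. -/
theorem abs_three_mul_sub_cube_le {C : ℝ} (hC : 0 ≤ C) {a : ℕ → ℝ}
    (ha : ∀ k : ℕ, 1 ≤ k → |a (k + 1) - a k - (k : ℝ) ^ 2| ≤ C * k) {k : ℕ} (hk : 1 ≤ k) :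
    |3 * a k - (k : ℝ) ^ 3| ≤ (3 * |a 1| + 3 * C + 4) * (k : ℝ) ^ 2 := by
  induction k, hk using Nat.le_induction with
  | base =>
    have h₁ := le_abs_self (a 1)
    have h₂ := neg_abs_le (a 1)
    rw [abs_le]
    constructor <;> norm_num <;> linarith
  | succ k hk ih =>
    have hstep := abs_le.1 (ha k hk)
    have hk' : (1 : ℝ) ≤ k := by exact_mod_cast hk
    have hCk : 0 ≤ C * k := by positivity
    have hak : 0 ≤ |a 1| * k := by positivity
    have ha₁ := abs_nonneg (a 1)
    rw [abs_le] at ih ⊢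
    push_cast
    constructor <;> nlinarith

/-- A bound for a difference of squares in terms of the difference of cubes. -/
theorem abs_sq_sub_sq_mul_le {y t : ℝ} (hy : 0 ≤ y) (ht : 0 ≤ t) :
    |y ^ 2 - t ^ 2| * t ≤ 2 * |y ^ 3 - t ^ 3| := by
  have hsq : |y ^ 2 - t ^ 2| = |y - t| * (y + t) := by
    rw [← abs_of_nonneg (add_nonneg hy ht)]
    rw [← abs_mul]
    ring_nf
  have hpos : 0 ≤ y ^ 2 + y * t + t ^ 2 := by positivity
  have hcube : |y ^ 3 - t ^ 3| = |y - t| * (y ^ 2 + y * t + t ^ 2) := by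
    rw [← abs_of_nonneg hpos, ← abs_mul]
    ring_nf
  have hle : (y + t) * t ≤ 2 * (y ^ 2 + y * t + t ^ 2) := by
    nlinarith [mul_nonneg hy ht, sq_nonneg y, sq_nonneg t]
  rw [hsq, hcube]
  nlinarith [mul_le_mul_of_nonneg_left hle (abs_nonneg (y - t))]

/-- If `x = t³ + O(t²)`, then `x^{2/3} = t² + O(t)`. -/
theorem abs_rpow_two_thirds_sub_sq_le {x t E : ℝ} (hx : 0 ≤ x) (ht : 0 < t)
    (h : |x - t ^ 3| ≤ E * t ^ 2) : |x ^ ((2 : ℝ) / 3) - t ^ 2| ≤ 2 * E * t := by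
  have hcube : (x ^ ((1 : ℝ) / 3)) ^ 3 = x := by
    rw [← Real.rpow_mul_natCast hx]
    norm_num
  have hsq : (x ^ ((1 : ℝ) / 3)) ^ 2 = x ^ ((2 : ℝ) / 3) := by
    rw [← Real.rpow_mul_natCast hx]
    norm_num
  have hdiff := abs_sq_sub_sq_mul_le (Real.rpow_nonneg hx ((1 : ℝ) / 3)) ht.le
  rw [hcube, hsq] at hdiff
  refine le_of_mul_le_mul_right ?_ ht
  linarith

/-- If `|α (k+1) − α k − k²| ≤ C k` for `k ≥ 1`, then writing
`n = α (k+1)` one has `(3n)^{2/3} = k² + O(k)` and `n − (3n)^{2/3} = α k + O(k)`. -/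
theorem stmt10 (C : ℝ) (hC : 0 < C) (α : ℕ → ℕ)
    (hα : ∀ k : ℕ, 1 ≤ k → |(α (k+1) : ℝ) - (α k : ℝ) - (k : ℝ)^2| ≤ C * k) :
    ∃ C' : ℝ, 0 < C' ∧ ∃ K : ℕ, ∀ k, K ≤ k →
      |(3 * (α (k+1) : ℝ)) ^ ((2:ℝ)/3) - (k : ℝ)^2| ≤ C' * k ∧
      |((α (k+1) : ℝ) - (3 * (α (k+1) : ℝ)) ^ ((2:ℝ)/3)) - (α k : ℝ)| ≤ C' * k := by
  set D : ℝ := 3 * |(α 1 : ℝ)| + 3 * C + 4 with hD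
  have hDpos : 0 < D := by positivity
  refine ⟨C + 2 * (D + 3 * C + 3), by positivity, 1, fun k hk => ?_⟩
  have hk' : (1 : ℝ) ≤ k := by exact_mod_cast hk
  have hstep := hα k hk
  have hcube : |3 * (α (k + 1) : ℝ) - (k : ℝ) ^ 3| ≤ (D + 3 * C + 3) * (k : ℝ) ^ 2 := by
    have hk3 := abs_le.1 (abs_three_mul_sub_cube_le hC.le (a := fun j => (α j : ℝ)) hα hk)
    have hstep' := abs_le.1 hstep
    have hCk : C * k ≤ C * (k : ℝ) ^ 2 := by gcongr; nlinarith
    rw [abs_le]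
    constructor <;> nlinarith
  have hroot := abs_rpow_two_thirds_sub_sq_le (by positivity) (by linarith) hcube
  have hCk : 0 ≤ C * k := by positivity
  refine ⟨by linarith, ?_⟩
  rw [abs_le] at hstep hroot ⊢
  constructor <;> linarith
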